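/- arXiv:1605.02841 — 3 statements merged into one kernel-verified Lean document; each statement's English description precedes it below -/
import Mathlib

section
/- Let L be a finite field extension of k = F_q(T) inside k̄. Then there exists a nonzero polynomial M ∈ F_q[T] such that μ(L) = Λ_M; in particular Λ_M ⊆ L, i.e., all q^{deg M} roots of the additive polynomial C_M(U) lie in L and they constitute exactly the Carlitz torsion of L. -/
open Polynomial IntermediateField

noncomputable section

variable (Fq : Type) [Field Fq] [Fintype Fq]

/-- A fixed algebraic closure of the rational function field `k = Fq(T)`. -/
abbrev Kbar := AlgebraicClosure (RatFunc Fq)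

/-- The Carlitz action of `T`: the `Fq`-linear map `u ↦ T•u + u^q`. -/
def carlitzT : Module.End Fq (Kbar Fq) where
  toFun u := algebraMap (RatFunc Fq) (Kbar Fq) RatFunc.X * u + u ^ Fintype.card Fq
  map_add' u v := by
    obtain ⟨n, hp, hcard⟩ := FiniteField.card Fq (ringChar Fq)
    haveI : Fact (ringChar Fq).Prime := ⟨hp⟩
    haveI : CharP (Kbar Fq) (ringChar Fq) :=
      charP_of_injective_algebraMap (algebraMap Fq (Kbar Fq)).injective _
    show algebraMap (RatFunc Fq) (Kbar Fq) RatFunc.X * (u + v) + (u + v) ^ Fintype.card Fq =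
      (algebraMap (RatFunc Fq) (Kbar Fq) RatFunc.X * u + u ^ Fintype.card Fq) +
        (algebraMap (RatFunc Fq) (Kbar Fq) RatFunc.X * v + v ^ Fintype.card Fq)
    rw [hcard, add_pow_char_pow]
    ring
  map_smul' c u := by
    simp only [RingHom.id_apply, smul_add, mul_smul_comm, _root_.smul_pow, FiniteField.pow_card]

/-- The Carlitz module: the `Fq`-algebra morphism `Fq[T] → End_{Fq}(k̄)`
determined by `T ↦ (u ↦ T·u + u^q)`. -/
def carlitzHom : Polynomial Fq →ₐ[Fq] Module.End Fq (Kbar Fq) :=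
  aeval (carlitzT Fq)

/-- The Carlitz action `C_a(u)`. -/
def carlitz (a : Polynomial Fq) (u : Kbar Fq) : Kbar Fq :=
  carlitzHom Fq a u

/-- `Λ_a = {u ∈ k̄ : C_a(u) = 0}`. -/
def Lambda (a : Polynomial Fq) : Set (Kbar Fq) := {u | carlitz Fq a u = 0}

/-- The Carlitz torsion `μ(L)` of an intermediate field `L`. -/
def carlitzTorsion (L : IntermediateField (RatFunc Fq) (Kbar Fq)) : Set (Kbar Fq) :=
  {u | u ∈ L ∧ ∃ a : Polynomial Fq, a ≠ 0 ∧ carlitz Fq a u = 0}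

/-- `DrinT(L/K) = {u ∈ L : C_m(u) ∈ K for some nonzero m}`. -/
def DrinT (K L : IntermediateField (RatFunc Fq) (Kbar Fq)) : Set (Kbar Fq) :=
  {u | u ∈ L ∧ ∃ m : Polynomial Fq, m ≠ 0 ∧ carlitz Fq m u ∈ K}

/-- `L/K` is radical: `L = K(X)` for some `X ⊆ DrinT(L/K)`. -/
def IsRadicalC (K L : IntermediateField (RatFunc Fq) (Kbar Fq)) : Prop :=
  ∃ X ⊆ DrinT Fq K L, L = adjoin (RatFunc Fq) ((K : Set (Kbar Fq)) ∪ X)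

/-- `L/K` is pure: every root in `L` of some `C_m`, `m` irreducible, lies in `K`. -/
def IsPureC (K L : IntermediateField (RatFunc Fq) (Kbar Fq)) : Prop :=
  ∀ m : Polynomial Fq, Irreducible m → ∀ u ∈ L, carlitz Fq m u = 0 → u ∈ K

/-- `L/K` is separable: every element of `L` is separable over `K`. -/
def IsSeparableC (K L : IntermediateField (RatFunc Fq) (Kbar Fq)) : Prop :=
  ∀ u ∈ L, IsSeparable K u

/-- `L/K` is cyclotomic coradical: radical, separable and pure. -/
def IsCycloCoradicalC (K L : IntermediateField (RatFunc Fq) (Kbar Fq)) : Prop :=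
  IsRadicalC Fq K L ∧ IsSeparableC Fq K L ∧ IsPureC Fq K L


set_option synthInstance.maxHeartbeats 1000000

section TotalDegree

variable {R : Type*} [CommRing R]

/-- A polynomial in `R[T][X]` has total degree at most `m`. -/
def TotalDegreeLE (f : R[X][X]) (m : ℕ) : Prop :=
  ∀ i, (f.coeff i).degree + i ≤ m

lemma TotalDegreeLE.add {f g : R[X][X]} {m : ℕ} (hf : TotalDegreeLE f m)
    (hg : TotalDegreeLE g m) : TotalDegreeLE (f + g) m := fun i ↦ by
  rw [coeff_add]
  rcases max_choice (f.coeff i).degree (g.coeff i).degree with h | h <;>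
    refine (add_le_add_left (degree_add_le _ _) _).trans ?_ <;> rw [h]
  exacts [hf i, hg i]

lemma TotalDegreeLE.mono {f : R[X][X]} {m n : ℕ} (hf : TotalDegreeLE f m) (h : m ≤ n) :
    TotalDegreeLE f n :=
  fun i ↦ (hf i).trans (by exact_mod_cast h)

lemma TotalDegreeLE.mul {f g : R[X][X]} {m n : ℕ} (hf : TotalDegreeLE f m)
    (hg : TotalDegreeLE g n) : TotalDegreeLE (f * g) (m + n) := fun i ↦ by
  have key : ∀ x ∈ Finset.HasAntidiagonal.antidiagonal i,
      (f.coeff x.1 * g.coeff x.2).degree + i ≤ (m + n : ℕ) := fun x hx ↦ by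
    rw [← Finset.HasAntidiagonal.mem_antidiagonal.mp hx]
    calc (f.coeff x.1 * g.coeff x.2).degree + ((x.1 + x.2 : ℕ) : WithBot ℕ)
        ≤ ((f.coeff x.1).degree + (g.coeff x.2).degree) + ((x.1 + x.2 : ℕ) : WithBot ℕ) :=
          add_le_add_left (degree_mul_le _ _) _
      _ = ((f.coeff x.1).degree + x.1) + ((g.coeff x.2).degree + x.2) := by
          push_cast; abel
      _ ≤ m + n := add_le_add (hf _) (hg _)
      _ = (m + n : ℕ) := by push_cast; rfl
  rw [coeff_mul]
  refine Finset.sum_induction _ (fun p : R[X] ↦ p.degree + i ≤ (m + n : ℕ))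
    (fun a b ha hb ↦ ?_) (by simp) key
  rcases max_choice a.degree b.degree with h | h <;>
    refine (add_le_add_left (degree_add_le _ _) _).trans ?_ <;> rw [h]
  exacts [ha, hb]

lemma totalDegreeLE_C {a : R[X]} {m : ℕ} (h : a.natDegree ≤ m) : TotalDegreeLE (C a) m := by
  intro i
  rw [coeff_C]
  split_ifs with hi
  · subst hi
    simpa using degree_le_of_natDegree_le h
  · simp

lemma totalDegreeLE_X : TotalDegreeLE (X : R[X][X]) 1 := by
  intro i
  rw [coeff_X]
  split_ifs with hi
  · subst hi
    simpa using add_le_add_left (degree_one_le (R := R)) 1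
  · simp

lemma TotalDegreeLE.pow {f : R[X][X]} {m : ℕ} (hf : TotalDegreeLE f m) (n : ℕ) :
    TotalDegreeLE (f ^ n) (m * n) := by
  induction n with
  | zero => simpa using totalDegreeLE_C (a := (1 : R[X])) (m := 0) (by simp)
  | succ n ih => simpa [pow_succ, mul_add] using ih.mul hf

lemma TotalDegreeLE.natDegree_coeff_le {f : R[X][X]} {m : ℕ} (hf : TotalDegreeLE f m) (i : ℕ) :
    (f.coeff i).natDegree ≤ m - i := by
  by_cases h : f.coeff i = 0
  · simp [h]
  · have := hf i
    rw [degree_eq_natDegree h] at this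
    have : (f.coeff i).natDegree + i ≤ m := by exact_mod_cast this
    omega

end TotalDegree

section Scaling

variable {F : Type*} [Field F]

open Classical in
lemma inftyValuation_algebraMap_mul_inv_pow_le_one_iff {a : F[X]} {k : ℕ} :
    RatFunc.inftyValuation F (algebraMap F[X] (RatFunc F) a * (RatFunc.X⁻¹) ^ k) ≤ 1 ↔
      a.natDegree ≤ k := by
  by_cases ha : a = 0
  · simp [ha]
  · rw [map_mul, RatFunc.inftyValuation_apply, RatFunc.inftyValuation.polynomial _ ha, map_pow,
      map_inv₀, RatFunc.inftyValuation.X, ← WithZero.exp_neg, ← WithZero.exp_nsmul,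
      ← WithZero.exp_add, ← WithZero.exp_zero, WithZero.exp_le_exp]
    simp

/-- A monic divisor of a monic `g` with total degree equal to its `X`-degree has the same
property. -/
lemma natDegree_coeff_le_of_dvd {f g : F[X][X]} (hf : f.Monic) (hg : g.Monic) (hfg : f ∣ g)
    (hT : ∀ i, (g.coeff i).natDegree ≤ g.natDegree - i) (i : ℕ) :
    (f.coeff i).natDegree ≤ f.natDegree - i := by
  classical
  let φ := algebraMap F[X] (RatFunc F)
  let O := (RatFunc.inftyValuation F).valuationSubring
  have hcoeff : ∀ {h : F[X][X]}, h.Monic → ∀ j, ((h.map φ).scaleRoots RatFunc.X⁻¹).coeff j =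
      φ (h.coeff j) * (RatFunc.X⁻¹) ^ (h.natDegree - j) := fun hh j ↦ by
    rw [coeff_scaleRoots, coeff_map, hh.natDegree_map]
  have hlift : ((g.map φ).scaleRoots RatFunc.X⁻¹) ∈ lifts (algebraMap O (RatFunc F)) := by
    rw [lifts_iff_coeff_lifts]
    intro j
    rw [hcoeff hg]
    refine ⟨⟨_, ?_⟩, rfl⟩
    rw [Valuation.mem_valuationSubring_iff]
    exact inftyValuation_algebraMap_mul_inv_pow_le_one_iff.mpr (hT j)
  obtain ⟨G, hG, -, hGm⟩ :=
    lifts_and_natDegree_eq_and_monic hlift ((monic_scaleRoots_iff _).mpr (hg.map φ))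
  have hint := isIntegral_coeff_of_dvd G ((f.map φ).scaleRoots RatFunc.X⁻¹) hGm
    ((monic_scaleRoots_iff _).mpr (hf.map φ))
    (by rw [hG]; exact scaleRoots_dvd _ _ (Polynomial.map_dvd φ hfg)) i
  obtain ⟨y, hy⟩ := IsIntegrallyClosed.isIntegral_iff.mp hint
  rw [← inftyValuation_algebraMap_mul_inv_pow_le_one_iff]
  change RatFunc.inftyValuation F (φ _ * _) ≤ 1
  rw [← hcoeff hf, ← hy]
  exact (Valuation.mem_valuationSubring_iff _ _).mp y.2

end Scaling

instance : IsScalarTower Fq Fq[X] (Kbar Fq) :=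
  IsScalarTower.of_algebraMap_eq fun c ↦ by
    rw [IsScalarTower.algebraMap_apply Fq (RatFunc Fq) (Kbar Fq),
      IsScalarTower.algebraMap_apply Fq[X] (RatFunc Fq) (Kbar Fq),
      IsScalarTower.algebraMap_apply Fq Fq[X] (RatFunc Fq)]

lemma carlitz_X_mul_add_C (a : Fq[X]) (c : Fq) (u : Kbar Fq) :
    carlitz Fq (a * X + C c) u =
      algebraMap Fq[X] (Kbar Fq) X * carlitz Fq a u + carlitz Fq a u ^ Fintype.card Fq +
        algebraMap Fq[X] (Kbar Fq) (C c) * u := by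
  have hC : carlitzHom Fq (C c) u = algebraMap Fq[X] (Kbar Fq) (C c) * u := by
    rw [carlitzHom, aeval_C, Module.algebraMap_end_apply, Algebra.smul_def,
      IsScalarTower.algebraMap_apply Fq Fq[X] (Kbar Fq)]
    rfl
  have hX : algebraMap Fq[X] (Kbar Fq) X = algebraMap (RatFunc Fq) (Kbar Fq) RatFunc.X := by
    rw [IsScalarTower.algebraMap_apply Fq[X] (RatFunc Fq) (Kbar Fq), RatFunc.algebraMap_X]
  rw [carlitz, map_add, LinearMap.add_apply, hC, hX, mul_comm a X, map_mul, Module.End.mul_apply]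
  congr 1
  rw [carlitzHom, aeval_X]
  rfl

/-- The polynomial realising the Carlitz action of a monic `M`. -/
lemma exists_carlitz_polynomial {M : Fq[X]} (hM : M.Monic) :
    ∃ f : Fq[X][X], f.Monic ∧ f.natDegree = Fintype.card Fq ^ M.natDegree ∧
      derivative f = C M ∧ TotalDegreeLE f f.natDegree ∧
      ∀ u : Kbar Fq, aeval u f = carlitz Fq M u := by
  have hq : 1 < Fintype.card Fq := Fintype.one_lt_card
  obtain ⟨d, hd⟩ : ∃ d, M.natDegree = d := ⟨_, rfl⟩
  induction d generalizing M with
  | zero =>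
    obtain rfl : M = 1 := hM.natDegree_eq_zero.mp hd
    refine ⟨X, monic_X, by simp, by simp, by simpa using totalDegreeLE_X, fun u ↦ ?_⟩
    simp [carlitz]
  | succ d ih =>
    have hdiv : (divX M).natDegree = d := by rw [natDegree_divX_eq_natDegree_tsub_one, hd]; simp
    have hmon : (divX M).Monic := by
      rw [Monic, leadingCoeff, hdiv, coeff_divX, ← hd]
      exact hM
    obtain ⟨f, hf, hfdeg, hfder, hfT, hfev⟩ := ih hmon hdiv
    set q := Fintype.card Fq with hqdef
    have hpos : 0 < f.natDegree := hfdeg ▸ pow_pos (by omega) _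
    have hqdeg : (f ^ q).natDegree = f.natDegree * q := by rw [hf.natDegree_pow, mul_comm]
    have hlt : f.natDegree < f.natDegree * q := lt_mul_of_one_lt_right hpos hq
    have hlow : (C X * f + C (C (M.coeff 0)) * X).natDegree < (f ^ q).natDegree := by
      rw [hqdeg]
      refine (natDegree_add_le_of_degree_le (n := f.natDegree) (natDegree_C_mul_le _ _)
        ((natDegree_C_mul_le _ _).trans ?_)).trans_lt hlt
      simpa using Nat.one_le_iff_ne_zero.mpr hpos.ne'
    have hdeg : (f ^ q + (C X * f + C (C (M.coeff 0)) * X)).natDegree = f.natDegree * q := by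
      rw [natDegree_add_eq_left_of_natDegree_lt hlow, hqdeg]
    refine ⟨f ^ q + (C X * f + C (C (M.coeff 0)) * X), ?_, ?_, ?_, ?_, fun u ↦ ?_⟩
    · exact (hf.pow q).add_of_left (degree_lt_degree hlow)
    · rw [hdeg, hfdeg, hd, hdiv, pow_succ]
    · have : ((q : ℕ) : Fq[X][X]) = 0 := by
        rw [← map_natCast (C.comp C : Fq →+* Fq[X][X]), hqdef, FiniteField.cast_card_eq_zero,
          map_zero]
      rw [derivative_add, derivative_add, derivative_pow, derivative_C_mul, derivative_C_mul,
        hfder, derivative_X, map_natCast, this]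
      conv_rhs => rw [← divX_mul_X_add M]
      simp only [map_add, map_mul]
      ring
    · rw [hdeg]
      refine (hfT.pow q).add (.add ?_ ?_)
      · refine ((totalDegreeLE_C (m := 1) (by simp)).mul hfT).mono ?_
        omega
      · refine ((totalDegreeLE_C (m := 0) (by simp)).mul totalDegreeLE_X).mono ?_
        omega
    · conv_rhs => rw [← divX_mul_X_add M, carlitz_X_mul_add_C, ← hfev]
      simp only [map_add, map_mul, map_pow, aeval_C, aeval_X]
      ring

lemma ncard_Lambda {M : Fq[X]} (hM : M.Monic) :
    (Lambda Fq M).ncard = Fintype.card Fq ^ M.natDegree := by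
  obtain ⟨f, hf, hfdeg, hfder, -, hfev⟩ := exists_carlitz_polynomial Fq hM
  let φ := algebraMap Fq[X] (RatFunc Fq)
  have hsep : (f.map φ).Separable := by
    have hder : derivative (f.map φ) = C (φ M) := by rw [derivative_map, hfder, map_C]
    rw [Separable, hder]
    have hne : φ M ≠ 0 := by simpa [φ] using hM.ne_zero
    exact ⟨0, C (φ M)⁻¹, by rw [zero_mul, zero_add, ← C_mul, inv_mul_cancel₀ hne, C_1]⟩
  have hset : Lambda Fq M = (f.map φ).rootSet (Kbar Fq) := by
    ext u
    rw [mem_rootSet_of_ne (hf.map φ).ne_zero, aeval_map_algebraMap, hfev]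
    rfl
  rw [hset, Set.ncard_eq_toFinset_card', Set.toFinset_card,
    card_rootSet_eq_natDegree hsep (IsAlgClosed.splits _), hf.natDegree_map, hfdeg]

lemma Lambda_finite {M : Fq[X]} (hM : M.Monic) : (Lambda Fq M).Finite :=
  Set.finite_of_ncard_pos (by rw [ncard_Lambda Fq hM]; exact pow_pos Fintype.card_pos _)

lemma exists_monic_of_carlitz_eq_zero {a : Fq[X]} (ha : a ≠ 0) {u : Kbar Fq}
    (hu : carlitz Fq a u = 0) : ∃ b : Fq[X], b.Monic ∧ carlitz Fq b u = 0 := by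
  refine ⟨C a.leadingCoeff⁻¹ * a, ?_, ?_⟩
  · rw [mul_comm]
    exact monic_mul_leadingCoeff_inv ha
  · rw [carlitz] at hu ⊢
    rw [map_mul, Module.End.mul_apply, hu, map_zero]

lemma carlitzTorsion_finite (L : IntermediateField (RatFunc Fq) (Kbar Fq))
    [FiniteDimensional (RatFunc Fq) L] : (carlitzTorsion Fq L).Finite := by
  classical
  set n := Module.finrank (RatFunc Fq) L
  have hfin : {a : Fq[X] | a.natDegree ≤ n}.Finite := by
    have : Finite (degreeLT Fq (n + 1)) := Finite.of_equiv _ (degreeLTEquiv Fq (n + 1)).symm.toEquiv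
    refine (Set.toFinite (degreeLT Fq (n + 1) : Set Fq[X])).subset fun a ha ↦ ?_
    exact mem_degreeLT.mpr
      ((degree_le_of_natDegree_le ha).trans_lt (by exact_mod_cast n.lt_succ_self))
  refine (bUnion_roots_finite (algebraMap Fq[X] (Kbar Fq)) n hfin).subset ?_
  rintro u ⟨huL, a, ha, hau⟩
  obtain ⟨b, hb, hbu⟩ := exists_monic_of_carlitz_eq_zero Fq ha hau
  obtain ⟨f, hf, -, -, hfT, hfev⟩ := exists_carlitz_polynomial Fq hb
  have hfu : aeval u f = 0 := (hfev u).trans hbu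
  have : Module.IsTorsionFree Fq[X] (Kbar Fq) := .trans_faithfulSMul Fq[X] (RatFunc Fq) (Kbar Fq)
  have hint : IsIntegral Fq[X] u := ⟨f, hf, hfu⟩
  have hmon := minpoly.monic hint
  have hdvd := minpoly.isIntegrallyClosed_dvd hint hfu
  have hdeg : (minpoly Fq[X] u).natDegree ≤ n := by
    rw [← hmon.natDegree_map (algebraMap Fq[X] (RatFunc Fq)),
      ← minpoly.isIntegrallyClosed_eq_field_fractions' (RatFunc Fq) hint]
    have := minpoly.natDegree_le (A := RatFunc Fq) (⟨u, huL⟩ : L)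
    rwa [IntermediateField.minpoly_eq] at this
  simp only [Set.mem_iUnion]
  refine ⟨minpoly Fq[X] u, ⟨hdeg, fun i ↦ ?_⟩, ?_⟩
  · exact (natDegree_coeff_le_of_dvd hmon hf hdvd hfT.natDegree_coeff_le i).trans
      ((Nat.sub_le _ _).trans hdeg)
  · simp only [Finset.mem_coe, Multiset.mem_toFinset]
    rw [mem_roots (hmon.map _).ne_zero, IsRoot, eval_map_algebraMap]
    exact minpoly.aeval _ _

/-- The Carlitz torsion of `L` as an `Fq`-subspace. -/
def carlitzTorsionSubmodule (L : IntermediateField (RatFunc Fq) (Kbar Fq)) :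
    Submodule Fq (Kbar Fq) where
  carrier := carlitzTorsion Fq L
  zero_mem' := ⟨zero_mem L, 1, one_ne_zero, map_zero (carlitzHom Fq 1)⟩
  add_mem' := by
    rintro u v ⟨hu, a, ha, hau⟩ ⟨hv, b, hb, hbv⟩
    refine ⟨add_mem hu hv, a * b, mul_ne_zero ha hb, ?_⟩
    rw [carlitz] at hau hbv ⊢
    rw [map_add]
    nth_rw 1 [mul_comm a b]
    rw [map_mul, map_mul, Module.End.mul_apply, Module.End.mul_apply, hau, hbv, map_zero, map_zero,
      add_zero]
  smul_mem' := by
    rintro c u ⟨hu, a, ha, hau⟩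
    refine ⟨?_, a, ha, ?_⟩
    · rw [Algebra.smul_def, IsScalarTower.algebraMap_apply Fq (RatFunc Fq) (Kbar Fq)]
      exact mul_mem (L.algebraMap_mem _) hu
    · rw [carlitz] at hau ⊢
      rw [map_smul, hau, smul_zero]

lemma carlitzT_mem_carlitzTorsion (L : IntermediateField (RatFunc Fq) (Kbar Fq)) :
    ∀ u ∈ carlitzTorsionSubmodule Fq L, carlitzT Fq u ∈ carlitzTorsionSubmodule Fq L := by
  rintro u ⟨hu, a, ha, hau⟩
  refine ⟨add_mem (mul_mem (L.algebraMap_mem _) hu) (pow_mem hu _), a, ha, ?_⟩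
  have hT : carlitzT Fq = carlitzHom Fq X := by rw [carlitzHom, aeval_X]
  rw [carlitz] at hau ⊢
  rw [hT, ← Module.End.mul_apply, ← map_mul, mul_comm, map_mul, Module.End.mul_apply, hau, map_zero]


/-- For a finite extension `L/k` inside `k̄` there is a nonzero
`M ∈ Fq[T]` with `μ(L) = Λ_M`; in particular `Λ_M ⊆ L`, and `Λ_M` consists of all
`q^(deg M)` roots of `C_M(U)`, which are exactly the Carlitz torsion of `L`. -/
theorem carlitzTorsion_eq_Lambda (L : IntermediateField (RatFunc Fq) (Kbar Fq))
    [FiniteDimensional (RatFunc Fq) L] :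
    ∃ M : Polynomial Fq, M ≠ 0 ∧ carlitzTorsion Fq L = Lambda Fq M ∧
      Lambda Fq M ⊆ (L : Set (Kbar Fq)) ∧
      (Lambda Fq M).ncard = Fintype.card Fq ^ M.natDegree := by
  let N := carlitzTorsionSubmodule Fq L
  have hfin : (carlitzTorsion Fq L).Finite := carlitzTorsion_finite Fq L
  have : Finite N := hfin
  let τ : Module.End Fq N := (carlitzT Fq).restrict (carlitzT_mem_carlitzTorsion Fq L)
  have hmon : τ.charpoly.Monic := τ.charpoly_monic
  have hsub : carlitzTorsion Fq L ⊆ Lambda Fq τ.charpoly := fun u hu ↦ by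
    have h := congrArg (fun g : Module.End Fq N ↦ (g ⟨u, hu⟩ : Kbar Fq)) τ.aeval_self_charpoly
    have hcomm : ∀ (p : Fq[X]) (x : N), ((aeval τ p x : N) : Kbar Fq) = carlitz Fq p x := by
      intro p x
      induction p using Polynomial.induction_on' with
      | add p r hp hr => simp_all [carlitz]
      | monomial k c =>
        rw [carlitz, carlitzHom, aeval_monomial, aeval_monomial, Module.End.mul_apply,
          Module.End.mul_apply, Module.End.pow_restrict]
        rfl
    exact (hcomm _ _).symm.trans h
  have hcard : (carlitzTorsion Fq L).ncard = Fintype.card Fq ^ τ.charpoly.natDegree := by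
    rw [LinearMap.charpoly_natDegree, ← Nat.card_eq_fintype_card, ← Module.natCard_eq_pow_finrank]
    rfl
  have heq : carlitzTorsion Fq L = Lambda Fq τ.charpoly :=
    Set.eq_of_subset_of_ncard_le hsub (by rw [hcard, ncard_Lambda Fq hmon])
      (Lambda_finite Fq hmon)
  exact ⟨τ.charpoly, hmon.ne_zero, heq, heq ▸ fun u hu ↦ hu.1, ncard_Lambda Fq hmon⟩

end
end

section
/- Assume q > 2. Let P ∈ F_q[T] be monic irreducible and n ≥ 1. Then the extension k(Λ_{P^n})/k(Λ_P) is cyclotomic coradical: it is radical, separable and pure. -/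
open Polynomial IntermediateField

noncomputable section

variable (Fq : Type) [Field Fq] [Fintype Fq]

section SubalgebraReduction

variable {A E : Type*} [CommRing A] [CommRing E] [Algebra A E] {B : Subalgebra A E} {m : A}

/-- If raising to the power `Q` is the identity on `B / mB`, then `B / mB` is reduced. -/
lemma exists_mem_eq_mul_of_pow_eq_mul {Q : ℕ} (hQ : 1 < Q)
    (hB : ∀ b ∈ B, ∃ z ∈ B, b ^ Q = b + algebraMap A E m * z) {b : E} (hb : b ∈ B) {N : ℕ}
    (h : ∃ z ∈ B, b ^ N = algebraMap A E m * z) : ∃ z ∈ B, b = algebraMap A E m * z := by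
  have iter : ∀ j : ℕ, ∃ z ∈ B, b ^ Q ^ j = b + algebraMap A E m * z := by
    intro j
    induction j with
    | zero => exact ⟨0, B.zero_mem, by simp⟩
    | succ j ih =>
      obtain ⟨z, hz, hzb⟩ := ih
      obtain ⟨w, hw, hwb⟩ := hB _ (B.pow_mem hb (Q ^ j))
      refine ⟨z + w, B.add_mem hz hw, ?_⟩
      rw [pow_succ, pow_mul, hwb, hzb]
      ring
  obtain ⟨z, hz, hzb⟩ := iter N
  obtain ⟨y, hy, hyb⟩ := h
  have hle : N ≤ Q ^ N := (Nat.lt_pow_self hQ).le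
  refine ⟨y * b ^ (Q ^ N - N) - z, B.sub_mem (B.mul_mem hy (B.pow_mem hb _)) hz, ?_⟩
  have hsplit : b ^ Q ^ N = b ^ N * b ^ (Q ^ N - N) := by
    rw [← pow_add, Nat.add_sub_cancel' hle]
  rw [hsplit, hyb] at hzb
  linear_combination -hzb

/-- If `B / mB` is reduced, then `B` contains every integral element `x` with `m x ∈ B`. -/
lemma IsIntegral.mem_of_mul_mem [IsDomain E] (hm : algebraMap A E m ≠ 0)
    (hred : ∀ b ∈ B, ∀ N : ℕ, (∃ z ∈ B, b ^ N = algebraMap A E m * z) →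
      ∃ z ∈ B, b = algebraMap A E m * z)
    {x : E} (hx : IsIntegral A x) (h : algebraMap A E m * x ∈ B) : x ∈ B := by
  obtain ⟨p, hp, hpx⟩ := hx
  have hs := scaleRoots_eval₂_eq_zero (s := m) (algebraMap A E) hpx
  have hsm : (p.scaleRoots m).Monic := (monic_scaleRoots_iff m).2 hp
  rw [hsm.as_sum, natDegree_scaleRoots] at hs
  simp only [eval₂_add, eval₂_pow, eval₂_X, eval₂_finsetSum, eval₂_mul, eval₂_C,
    coeff_scaleRoots] at hs
  have hmem : ∃ z ∈ B, (algebraMap A E m * x) ^ p.natDegree = algebraMap A E m * z := by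
    refine ⟨-∑ i ∈ Finset.range p.natDegree,
      algebraMap A E (p.coeff i * m ^ (p.natDegree - i - 1)) * (algebraMap A E m * x) ^ i,
      B.neg_mem (B.sum_mem fun i _ => B.mul_mem (B.algebraMap_mem _) (B.pow_mem h i)), ?_⟩
    rw [eq_neg_of_add_eq_zero_left hs, mul_neg, Finset.mul_sum]
    congr 1
    refine Finset.sum_congr rfl fun i hi => ?_
    have hi' : p.natDegree - i = (p.natDegree - i - 1) + 1 := by
      have := Finset.mem_range.1 hi
      omega
    conv_lhs => rw [hi']
    simp only [map_mul, map_pow]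
    ring
  obtain ⟨z, hz, hzx⟩ := hred _ h _ hmem
  rwa [mul_left_cancel₀ hm hzx]

/-- If `B / mB` is reduced, powers of `m` can be cleared from denominators of integral elements. -/
lemma IsIntegral.mem_of_pow_mul_mem [IsDomain E] (hm : algebraMap A E m ≠ 0)
    (hred : ∀ b ∈ B, ∀ N : ℕ, (∃ z ∈ B, b ^ N = algebraMap A E m * z) →
      ∃ z ∈ B, b = algebraMap A E m * z)
    {x : E} (hx : IsIntegral A x) (k : ℕ) (h : algebraMap A E m ^ k * x ∈ B) : x ∈ B := by
  induction k with
  | zero => simpa using h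
  | succ k ih =>
    refine ih (IsIntegral.mem_of_mul_mem hm hred ?_ (by rwa [← mul_assoc, ← pow_succ']))
    rw [← map_pow]
    exact isIntegral_algebraMap.mul hx

end SubalgebraReduction

lemma add_pow_card_pow {R : Type*} [CommRing R] [Algebra Fq R] (x y : R) (i : ℕ) :
    (x + y) ^ Fintype.card Fq ^ i = x ^ Fintype.card Fq ^ i + y ^ Fintype.card Fq ^ i := by
  induction i with
  | zero => simp
  | succ i ih =>
    rw [pow_succ, pow_mul, ih, pow_mul, pow_mul]
    exact map_add (FiniteField.frobeniusAlgHom Fq R) _ _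

/-- The coefficient of `u ^ q ^ i` in `C_{T ^ n}(u)`. -/
def carlitzCoeffXPow : ℕ → ℕ → Fq[X]
  | 0, 0 => 1
  | 0, _ + 1 => 0
  | n + 1, 0 => X * carlitzCoeffXPow n 0
  | n + 1, i + 1 =>
    X ^ Fintype.card Fq ^ (i + 1) * carlitzCoeffXPow n (i + 1) + carlitzCoeffXPow n i

/-- The coefficient of `u ^ q ^ i` in `C_a(u)`. -/
def carlitzCoeff (a : Fq[X]) (i : ℕ) : Fq[X] :=
  ∑ n ∈ Finset.range (a.natDegree + 1), C (a.coeff n) * carlitzCoeffXPow Fq n i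

lemma carlitzCoeffXPow_zero_right (n : ℕ) : carlitzCoeffXPow Fq n 0 = X ^ n := by
  induction n with
  | zero => simp [carlitzCoeffXPow]
  | succ n ih => rw [carlitzCoeffXPow, ih, pow_succ']

lemma carlitzCoeffXPow_of_lt {n i : ℕ} (h : n < i) : carlitzCoeffXPow Fq n i = 0 := by
  induction n generalizing i with
  | zero =>
    obtain ⟨i, rfl⟩ := Nat.exists_eq_add_of_lt h
    simp [carlitzCoeffXPow]
  | succ n ih =>
    obtain _ | i := i
    · omega
    · rw [carlitzCoeffXPow, ih (by omega), ih (by omega)]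
      simp

lemma carlitzCoeffXPow_self (n : ℕ) : carlitzCoeffXPow Fq n n = 1 := by
  induction n with
  | zero => simp [carlitzCoeffXPow]
  | succ n ih => rw [carlitzCoeffXPow, ih, carlitzCoeffXPow_of_lt Fq (Nat.lt_succ_self n)]; simp

/-- Comparison of coefficients in `C_T ∘ C_{T ^ n} = C_{T ^ n} ∘ C_T`. -/
lemma carlitzCoeffXPow_comm (n i : ℕ) :
    X * carlitzCoeffXPow Fq n (i + 1) + carlitzCoeffXPow Fq n i ^ Fintype.card Fq =
      X ^ Fintype.card Fq ^ (i + 1) * carlitzCoeffXPow Fq n (i + 1) +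
        carlitzCoeffXPow Fq n i := by
  have hadd (x y : Fq[X]) : (x + y) ^ Fintype.card Fq = x ^ Fintype.card Fq + y ^ Fintype.card Fq :=
    map_add (FiniteField.frobeniusAlgHom Fq Fq[X]) x y
  induction n generalizing i with
  | zero => cases i <;> simp [carlitzCoeffXPow, Fintype.card_ne_zero]
  | succ n ih =>
    obtain _ | i := i
    · have := ih 0
      simp only [carlitzCoeffXPow, carlitzCoeffXPow_zero_right, mul_pow, zero_add, pow_one] at *
      linear_combination (X ^ Fintype.card Fq) * this
    · have h1 := ih (i + 1)
      have h2 := ih i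
      simp only [carlitzCoeffXPow, hadd, mul_pow, ← pow_mul, ← pow_succ] at *
      linear_combination (X ^ Fintype.card Fq ^ (i + 1 + 1)) * h1 + h2

lemma carlitzCoeff_zero_right (a : Fq[X]) : carlitzCoeff Fq a 0 = a := by
  simp only [carlitzCoeff, carlitzCoeffXPow_zero_right]
  exact a.as_sum_range_C_mul_X_pow.symm

lemma carlitzCoeff_natDegree (a : Fq[X]) :
    carlitzCoeff Fq a a.natDegree = C a.leadingCoeff := by
  rw [carlitzCoeff, Finset.sum_range_succ, Finset.sum_eq_zero, carlitzCoeffXPow_self]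
  · simp
  · intro n hn
    rw [carlitzCoeffXPow_of_lt Fq (Finset.mem_range.1 hn), mul_zero]

lemma carlitzCoeff_comm (a : Fq[X]) (i : ℕ) :
    X * carlitzCoeff Fq a (i + 1) + carlitzCoeff Fq a i ^ Fintype.card Fq =
      X ^ Fintype.card Fq ^ (i + 1) * carlitzCoeff Fq a (i + 1) + carlitzCoeff Fq a i := by
  have hsum : carlitzCoeff Fq a i ^ Fintype.card Fq = ∑ n ∈ Finset.range (a.natDegree + 1),
      C (a.coeff n) * carlitzCoeffXPow Fq n i ^ Fintype.card Fq := by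
    refine (map_sum (FiniteField.frobeniusAlgHom Fq Fq[X]) _ _).trans ?_
    refine Finset.sum_congr rfl fun n _ => ?_
    simp only [FiniteField.coe_frobeniusAlgHom, mul_pow, ← C_pow, FiniteField.pow_card]
  rw [hsum]
  simp only [carlitzCoeff, Finset.mul_sum, ← Finset.sum_add_distrib]
  refine Finset.sum_congr rfl fun n _ => ?_
  linear_combination C (a.coeff n) * carlitzCoeffXPow_comm Fq n i

/-- For `m` irreducible of degree `d`, the coefficients of `C_m` below `u ^ q ^ d` vanish
modulo `m`. -/
lemma Irreducible.dvd_carlitzCoeff {m : Fq[X]} (hm : Irreducible m) {i : ℕ}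
    (hi : i < m.natDegree) : m ∣ carlitzCoeff Fq m i := by
  induction i with
  | zero => rw [carlitzCoeff_zero_right]
  | succ i ih =>
    obtain ⟨c, hc⟩ := ih (by omega)
    have hprod : m ∣ (X ^ Fintype.card Fq ^ (i + 1) - X) * carlitzCoeff Fq m (i + 1) := by
      have : (X ^ Fintype.card Fq ^ (i + 1) - X) * carlitzCoeff Fq m (i + 1) =
          carlitzCoeff Fq m i ^ Fintype.card Fq - carlitzCoeff Fq m i := by
        linear_combination -carlitzCoeff_comm Fq m i
      rw [this]
      have hdvd : m ∣ carlitzCoeff Fq m i := ⟨c, hc⟩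
      exact dvd_sub (dvd_pow hdvd Fintype.card_ne_zero) hdvd
    refine (hm.prime.dvd_or_dvd hprod).resolve_left fun h => ?_
    rw [Fintype.card_eq_nat_card] at h
    have := Nat.le_of_dvd (Nat.succ_pos i) (hm.natDegree_dvd_of_dvd_X_pow_card_pow_sub_X h)
    omega

lemma Irreducible.dvd_pow_card_pow_natDegree_sub {m : Fq[X]} (hm : Irreducible m) (a : Fq[X]) :
    m ∣ a ^ Fintype.card Fq ^ m.natDegree - a := by
  induction a using Polynomial.induction_on' with
  | add f g hf hg =>
    rw [add_pow_card_pow]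
    convert dvd_add hf hg using 1
    ring
  | monomial n c =>
    have hX : m ∣ X ^ Fintype.card Fq ^ m.natDegree - X := by
      rw [Fintype.card_eq_nat_card]
      exact hm.natDegree_dvd_iff_dvd_X_pow_card_pow_sub_X.1 dvd_rfl
    rw [← C_mul_X_pow_eq_monomial, mul_pow, ← C_pow, FiniteField.pow_card_pow, ← mul_sub,
      ← pow_mul, mul_comm n, pow_mul]
    exact ((hX.trans (sub_dvd_pow_sub_pow _ _ n)).mul_left _)

lemma carlitz_zero_right (a : Fq[X]) : carlitz Fq a 0 = 0 :=
  map_zero _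

lemma carlitz_mul (a b : Fq[X]) (u : Kbar Fq) :
    carlitz Fq (a * b) u = carlitz Fq a (carlitz Fq b u) := by
  simp [carlitz, Module.End.mul_apply]

lemma carlitz_add (a b : Fq[X]) (u : Kbar Fq) :
    carlitz Fq (a + b) u = carlitz Fq a u + carlitz Fq b u := by
  simp [carlitz]

lemma carlitz_one (u : Kbar Fq) : carlitz Fq 1 u = u := by
  simp [carlitz]

lemma carlitz_C (c : Fq) (u : Kbar Fq) : carlitz Fq (C c) u = c • u := by
  simp [carlitz, carlitzHom]

lemma carlitz_X (u : Kbar Fq) :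
    carlitz Fq X u = algebraMap Fq[X] (Kbar Fq) X * u + u ^ Fintype.card Fq := by
  simp [carlitz, carlitzHom, carlitzT, IsScalarTower.algebraMap_apply Fq[X] (RatFunc Fq) (Kbar Fq)]

lemma algebraMap_C_kbar (F : Type) [Field F] (c : F) :
    algebraMap F[X] (Kbar F) (C c) = algebraMap F (Kbar F) c :=
  (IsScalarTower.algebraMap_apply F F[X] (Kbar F) c).symm

lemma algebraMap_kbar_injective (F : Type) [Field F] :
    Function.Injective (algebraMap F[X] (Kbar F)) := by
  rw [IsScalarTower.algebraMap_eq F[X] (RatFunc F) (Kbar F)]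
  exact (algebraMap (RatFunc F) (Kbar F)).injective.comp (RatFunc.algebraMap_injective F)

lemma carlitz_X_pow_eq_sum (n : ℕ) {N : ℕ} (hN : n < N) (u : Kbar Fq) :
    carlitz Fq (X ^ n) u = ∑ i ∈ Finset.range N,
      algebraMap Fq[X] (Kbar Fq) (carlitzCoeffXPow Fq n i) * u ^ Fintype.card Fq ^ i := by
  induction n generalizing u N with
  | zero =>
    obtain ⟨N, rfl⟩ := Nat.exists_eq_succ_of_ne_zero hN.ne'
    simp [Finset.sum_range_succ', carlitzCoeffXPow, carlitz_one]
  | succ n ih =>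
    obtain ⟨N, rfl⟩ := Nat.exists_eq_succ_of_ne_zero (Nat.ne_zero_of_lt hN)
    have hn : n < N := by omega
    rw [pow_succ, carlitz_mul, ih (hn.trans N.lt_succ_self), carlitz_X]
    simp only [add_pow_card_pow, mul_add, Finset.sum_add_distrib]
    rw [Finset.sum_range_succ' (fun i => _ * (_ * u) ^ _),
      Finset.sum_range_succ (fun i => _ * (u ^ _) ^ _),
      Finset.sum_range_succ' (fun i => _ * u ^ _), carlitzCoeffXPow_of_lt Fq hn]
    simp only [carlitzCoeffXPow, map_add, map_mul, map_pow, map_zero, zero_mul, add_zero,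
      add_mul, Finset.sum_add_distrib]
    rw [add_right_comm]
    congr 1
    · congr 1
      · refine Finset.sum_congr rfl fun i _ => ?_
        ring
      · refine Finset.sum_congr rfl fun i _ => ?_
        rw [← pow_mul, ← pow_succ']
    · ring

lemma carlitz_eq_sum (a : Fq[X]) (u : Kbar Fq) :
    carlitz Fq a u = ∑ i ∈ Finset.range (a.natDegree + 1),
      algebraMap Fq[X] (Kbar Fq) (carlitzCoeff Fq a i) * u ^ Fintype.card Fq ^ i := by
  have hsum : carlitz Fq a u = ∑ n ∈ Finset.range (a.natDegree + 1),
      a.coeff n • carlitz Fq (X ^ n) u := by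
    conv_lhs => rw [a.as_sum_range_C_mul_X_pow]
    simp only [← carlitz_C, ← carlitz_mul]
    simp [carlitz]
  rw [hsum]
  simp only [carlitzCoeff, map_sum, Finset.sum_mul, map_mul, algebraMap_C_kbar]
  rw [Finset.sum_comm]
  refine Finset.sum_congr rfl fun n hn => ?_
  rw [carlitz_X_pow_eq_sum Fq n (Finset.mem_range.1 hn), Finset.smul_sum]
  refine Finset.sum_congr rfl fun i _ => ?_
  rw [Algebra.smul_def, mul_assoc]

/-- For `q > 2`, the polynomial `C_a(u) - a u` is divisible by `u ^ 3`. -/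
lemma exists_carlitz_eq_mul_add (hq : 2 < Fintype.card Fq) (a : Fq[X]) :
    ∃ h : Fq[X][X], ∀ u : Kbar Fq,
      carlitz Fq a u = algebraMap Fq[X] (Kbar Fq) a * u + u ^ 3 * aeval u h := by
  refine ⟨∑ i ∈ Finset.range a.natDegree,
    C (carlitzCoeff Fq a (i + 1)) * X ^ (Fintype.card Fq ^ (i + 1) - 3), fun u => ?_⟩
  rw [carlitz_eq_sum, Finset.sum_range_succ', carlitzCoeff_zero_right, pow_zero, pow_one, add_comm]
  congr 1
  simp only [map_sum, map_mul, aeval_C, map_pow, aeval_X, Finset.mul_sum]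
  refine Finset.sum_congr rfl fun i _ => ?_
  have hle : 3 ≤ Fintype.card Fq ^ (i + 1) :=
    Nat.le_trans hq (Nat.le_self_pow (Nat.succ_ne_zero i) _)
  rw [mul_left_comm, ← pow_add, Nat.add_sub_cancel' hle]

lemma degree_sum_C_mul_X_pow_card_pow_lt (c : ℕ → Fq[X]) (d : ℕ) :
    (∑ i ∈ Finset.range d, C (c i) * X ^ Fintype.card Fq ^ i).degree <
      ((Fintype.card Fq ^ d : ℕ) : WithBot ℕ) := by
  refine (degree_sum_le _ _).trans_lt ((Finset.sup_lt_iff (WithBot.bot_lt_coe _)).2 ?_)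
  intro i hi
  refine (degree_C_mul_X_pow_le _ _).trans_lt (WithBot.coe_lt_coe.2 ?_)
  exact Nat.pow_lt_pow_right Fintype.one_lt_card (Finset.mem_range.1 hi)

/-- For `m` monic irreducible of degree `d`, one has `C_m(u) ≡ u ^ q ^ d` modulo `m`. -/
lemma exists_carlitz_eq_pow_add {m : Fq[X]} (hm : Irreducible m) (hmonic : m.Monic) :
    ∃ h : Fq[X][X], ∀ u : Kbar Fq,
      carlitz Fq m u = u ^ Fintype.card Fq ^ m.natDegree +
        algebraMap Fq[X] (Kbar Fq) m * aeval u h := by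
  choose! c hc using fun i (hi : i < m.natDegree) => hm.dvd_carlitzCoeff Fq hi
  refine ⟨∑ i ∈ Finset.range m.natDegree, C (c i) * X ^ Fintype.card Fq ^ i, fun u => ?_⟩
  rw [carlitz_eq_sum, Finset.sum_range_succ, carlitzCoeff_natDegree, hmonic.leadingCoeff, add_comm]
  simp only [map_one, one_mul, map_sum, map_mul, aeval_C, map_pow, aeval_X, Finset.mul_sum]
  congr 1
  refine Finset.sum_congr rfl fun i hi => ?_
  rw [hc i (Finset.mem_range.1 hi), map_mul, mul_assoc]

lemma isIntegral_of_carlitz_eq_zero {a : Fq[X]} (ha : a.Monic) {u : Kbar Fq}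
    (hu : carlitz Fq a u = 0) : IsIntegral Fq[X] u := by
  let f : Fq[X][X] := ∑ i ∈ Finset.range a.natDegree,
    C (carlitzCoeff Fq a i) * X ^ Fintype.card Fq ^ i
  have hdeg : f.degree < ((Fintype.card Fq ^ a.natDegree : ℕ) : WithBot ℕ) :=
    degree_sum_C_mul_X_pow_card_pow_lt Fq _ _
  refine ⟨X ^ Fintype.card Fq ^ a.natDegree + f, monic_X_pow_add hdeg, ?_⟩
  rw [carlitz_eq_sum, Finset.sum_range_succ, carlitzCoeff_natDegree, ha.leadingCoeff] at hu
  rw [← hu, eval₂_add, add_comm]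
  simp [f, eval₂_finsetSum]

/-- The torsion points of a nonzero `a` are separable over `k`. -/
lemma isSeparable_of_carlitz_eq_zero {a : Fq[X]} (ha : a ≠ 0) {u : Kbar Fq}
    (hu : carlitz Fq a u = 0) : IsSeparable (RatFunc Fq) u := by
  let f : (RatFunc Fq)[X] := ∑ i ∈ Finset.range (a.natDegree + 1),
    C (algebraMap Fq[X] (RatFunc Fq) (carlitzCoeff Fq a i)) * X ^ Fintype.card Fq ^ i
  have hroot : aeval u f = 0 := by
    rw [← hu, carlitz_eq_sum]
    simp only [f, map_sum, map_mul, aeval_C, map_pow, aeval_X, ← IsScalarTower.algebraMap_apply]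
  have hcard : (Fintype.card Fq : (RatFunc Fq)[X]) = 0 := by
    rw [← map_natCast (algebraMap Fq (RatFunc Fq)[X]), FiniteField.cast_card_eq_zero, map_zero]
  have hderiv : derivative f = C (algebraMap Fq[X] (RatFunc Fq) a) := by
    simp [f, Finset.sum_range_succ', carlitzCoeff_zero_right, derivative_X_pow, hcard]
  have hsep : f.Separable := by
    rw [Separable, hderiv]
    refine isCoprime_one_right.of_isCoprime_of_dvd_right (IsUnit.dvd ?_)
    exact isUnit_C.2 ((map_ne_zero_iff _ (RatFunc.algebraMap_injective Fq)).2 ha).isUnit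
  exact hsep.of_dvd (minpoly.dvd _ _ hroot)

lemma Lambda_subset_of_dvd {a b : Fq[X]} (h : a ∣ b) : Lambda Fq a ⊆ Lambda Fq b := by
  obtain ⟨c, rfl⟩ := h
  intro u (hu : carlitz Fq a u = 0)
  change carlitz Fq (a * c) u = 0
  rw [mul_comm, carlitz_mul, hu, carlitz_zero_right]

lemma aeval_mem_subalgebra {A E : Type*} [CommRing A] [CommRing E] [Algebra A E]
    (B : Subalgebra A E) {x : E} (hx : x ∈ B) (h : A[X]) : aeval x h ∈ B :=
  Algebra.adjoin_le (Set.singleton_subset_iff.2 hx) (aeval_mem_adjoin_singleton A x)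

/-- In a subalgebra, `C_{m ^ j}(x) ≡ x ^ q ^ (d j)` modulo `m`. -/
lemma exists_carlitz_pow_eq (B : Subalgebra Fq[X] (Kbar Fq)) {m : Fq[X]} (hm : Irreducible m)
    (hmonic : m.Monic) {x : Kbar Fq} (hx : x ∈ B) (j : ℕ) :
    ∃ z ∈ B, x ^ Fintype.card Fq ^ (m.natDegree * j) =
      carlitz Fq (m ^ j) x + algebraMap Fq[X] (Kbar Fq) m * z := by
  obtain ⟨h, hh⟩ := exists_carlitz_eq_pow_add Fq hm hmonic
  have hq0 : Fintype.card Fq ^ m.natDegree ≠ 0 := pow_ne_zero _ Fintype.card_ne_zero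
  induction j with
  | zero => exact ⟨0, B.zero_mem, by simp [carlitz_one]⟩
  | succ j ih =>
    obtain ⟨z, hz, hzx⟩ := ih
    have hc : carlitz Fq (m ^ j) x ∈ B := by
      rw [← sub_eq_iff_eq_add.2 hzx]
      exact B.sub_mem (B.pow_mem hx _) (B.mul_mem (B.algebraMap_mem _) hz)
    obtain ⟨r, hr⟩ := Nat.exists_eq_succ_of_ne_zero hq0
    refine ⟨algebraMap Fq[X] (Kbar Fq) m ^ r * z ^ Fintype.card Fq ^ m.natDegree -
      aeval (carlitz Fq (m ^ j) x) h, B.sub_mem (B.mul_mem (B.pow_mem (B.algebraMap_mem _) _)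
        (B.pow_mem hz _)) (aeval_mem_subalgebra B hc h), ?_⟩
    have hpow : algebraMap Fq[X] (Kbar Fq) m ^ Fintype.card Fq ^ m.natDegree =
        algebraMap Fq[X] (Kbar Fq) m * algebraMap Fq[X] (Kbar Fq) m ^ r := by
      rw [hr, pow_succ']
    rw [Nat.mul_succ, pow_add, pow_mul, hzx, add_pow_card_pow, mul_pow, hpow, pow_succ', carlitz_mul,
      hh]
    ring

lemma exists_pow_dvd_sub_one {m M : Fq[X]} (hM : M.Monic) (h : IsCoprime m M) :
    ∃ j : ℕ, 0 < j ∧ M ∣ m ^ j - 1 := by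
  have : Module.Finite Fq (Fq[X] ⧸ Ideal.span {M}) :=
    hM.finite_quotient
  have : Finite (Fq[X] ⧸ Ideal.span {M}) := Module.finite_of_finite Fq
  obtain ⟨a, b, hab⟩ := h
  have hu : IsUnit (Ideal.Quotient.mk (Ideal.span {M}) m) := by
    refine IsUnit.of_mul_eq_one (Ideal.Quotient.mk _ a) ?_
    rw [← map_mul, ← map_one (Ideal.Quotient.mk _), Ideal.Quotient.eq, Ideal.mem_span_singleton]
    exact ⟨-b, by linear_combination hab⟩
  obtain ⟨v, hv⟩ := hu
  refine ⟨orderOf v, orderOf_pos v, ?_⟩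
  rw [← Ideal.mem_span_singleton, ← Ideal.Quotient.eq, map_pow, ← hv, ← Units.val_pow_eq_pow_val,
    pow_orderOf_eq_one]
  simp

/-- If `m` is coprime to `M`, some power map is the identity on `A[Λ_M] / m A[Λ_M]`. -/
lemma exists_pow_eq_on_adjoin_Lambda {m M : Fq[X]} (hm : Irreducible m) (hmonic : m.Monic)
    (hM : M.Monic) (hcop : IsCoprime m M) :
    ∃ Q : ℕ, 1 < Q ∧ ∀ b ∈ Algebra.adjoin Fq[X] (Lambda Fq M),
      ∃ z ∈ Algebra.adjoin Fq[X] (Lambda Fq M),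
        b ^ Q = b + algebraMap Fq[X] (Kbar Fq) m * z := by
  obtain ⟨j, hj, hdvd⟩ := exists_pow_dvd_sub_one Fq hM hcop
  set B := Algebra.adjoin Fq[X] (Lambda Fq M)
  have hd : m.natDegree ≠ 0 := hm.natDegree_pos.ne'
  refine ⟨Fintype.card Fq ^ (m.natDegree * j),
    Nat.one_lt_pow (mul_ne_zero hd hj.ne') Fintype.one_lt_card, fun b hb => ?_⟩
  induction hb using Algebra.adjoin_induction with
  | mem x hx =>
    obtain ⟨z, hz, hzx⟩ :=
      exists_carlitz_pow_eq Fq B hm hmonic (Algebra.subset_adjoin hx) j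
    refine ⟨z, hz, ?_⟩
    have h1 : carlitz Fq (m ^ j - 1) x = 0 := Lambda_subset_of_dvd Fq hdvd hx
    rw [hzx]
    congr 1
    conv_lhs => rw [← sub_add_cancel (m ^ j) 1]
    rw [carlitz_add, h1, carlitz_one, zero_add]
  | algebraMap a =>
    have hdiv : m ∣ a ^ Fintype.card Fq ^ (m.natDegree * j) - a := by
      clear hj hdvd
      induction j with
      | zero => simp
      | succ j ih =>
        rw [Nat.mul_succ, pow_add, pow_mul]
        convert dvd_add (hm.dvd_pow_card_pow_natDegree_sub Fq
          (a ^ Fintype.card Fq ^ (m.natDegree * j))) ih using 1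
        ring
    obtain ⟨c, hc⟩ := hdiv
    refine ⟨algebraMap _ _ c, B.algebraMap_mem c, ?_⟩
    rw [← map_pow, ← map_mul, ← map_add, ← hc]
    congr 1
    ring
  | add x y hx hy ihx ihy =>
    obtain ⟨z, hz, hzx⟩ := ihx
    obtain ⟨w, hw, hwy⟩ := ihy
    refine ⟨z + w, B.add_mem hz hw, ?_⟩
    rw [add_pow_card_pow, hzx, hwy]
    ring
  | mul x y hx hy ihx ihy =>
    obtain ⟨z, hz, hzx⟩ := ihx
    obtain ⟨w, hw, hwy⟩ := ihy
    refine ⟨z * (y + algebraMap Fq[X] (Kbar Fq) m * w) + x * w,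
      B.add_mem (B.mul_mem hz (B.add_mem hy (B.mul_mem (B.algebraMap_mem _) hw)))
        (B.mul_mem hx hw), ?_⟩
    rw [mul_pow, hzx, hwy]
    ring

lemma exists_mul_mem_adjoin (F : Type) [Field F] {S : Set (Kbar F)} {u : Kbar F}
    (hu : u ∈ adjoin (RatFunc F) S) :
    ∃ s : F[X], s ≠ 0 ∧ algebraMap F[X] (Kbar F) s * u ∈ Algebra.adjoin F[X] S := by
  rw [← mem_toSubalgebra, adjoin_toSubalgebra] at hu
  obtain ⟨t, ht⟩ := multiple_mem_adjoin_of_mem_localization_adjoin (nonZeroDivisors F[X])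
    (RatFunc F) S u hu
  refine ⟨t, nonZeroDivisors.coe_ne_zero t, ?_⟩
  rwa [← Algebra.smul_def]

/-- For `q > 2` and `m` coprime to `M`, the field `k(Λ_M)` contains no nontrivial
`m`-torsion. -/
lemma eq_zero_of_mem_adjoin_Lambda (hq : 2 < Fintype.card Fq) {m M : Fq[X]} (hm : Irreducible m)
    (hmonic : m.Monic) (hM : M.Monic) (hcop : IsCoprime m M) {u : Kbar Fq}
    (huL : u ∈ adjoin (RatFunc Fq) (Lambda Fq M)) (hu : carlitz Fq m u = 0) : u = 0 := by
  by_contra hu0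
  obtain ⟨Q, hQ, hB⟩ := exists_pow_eq_on_adjoin_Lambda Fq hm hmonic hM hcop
  obtain ⟨s₀, hs₀, hs₀u⟩ := exists_mul_mem_adjoin Fq huL
  set B := Algebra.adjoin Fq[X] (Lambda Fq M)
  have hinj := algebraMap_kbar_injective Fq
  have hm0 : algebraMap Fq[X] (Kbar Fq) m ≠ 0 := (map_ne_zero_iff _ hinj).2 hm.ne_zero
  have hred (b) (hb : b ∈ B) (N : ℕ) := exists_mem_eq_mul_of_pow_eq_mul (N := N) hQ hB hb
  have hint : IsIntegral Fq[X] u := isIntegral_of_carlitz_eq_zero Fq hmonic hu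
  have hint_aeval (h : Fq[X][X]) : IsIntegral Fq[X] (aeval u h) :=
    aeval_mem_subalgebra (integralClosure Fq[X] (Kbar Fq)) hint h
  obtain ⟨s, hs, hsu⟩ : ∃ s : Fq[X], ¬ m ∣ s ∧ algebraMap Fq[X] (Kbar Fq) s * u ∈ B := by
    obtain ⟨s, hs₀s, hs⟩ :=
      (FiniteMultiplicity.of_prime_left hm.prime hs₀).exists_eq_pow_mul_and_not_dvd
    refine ⟨s, hs, IsIntegral.mem_of_pow_mul_mem hm0 hred (isIntegral_algebraMap.mul hint)
      (multiplicity m s₀) ?_⟩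
    rwa [← mul_assoc, ← map_pow, ← map_mul, ← hs₀s]
  have hs0 : algebraMap Fq[X] (Kbar Fq) s ≠ 0 :=
    (map_ne_zero_iff _ hinj).2 fun h => hs (h ▸ dvd_zero m)
  obtain ⟨h, hh⟩ := exists_carlitz_eq_pow_add Fq hm hmonic
  obtain ⟨w, hw, hsw⟩ : ∃ w ∈ B, algebraMap Fq[X] (Kbar Fq) s * u =
      algebraMap Fq[X] (Kbar Fq) m * w := by
    have hpow : (algebraMap Fq[X] (Kbar Fq) s * u) ^ Fintype.card Fq ^ m.natDegree =
        algebraMap Fq[X] (Kbar Fq) m *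
          -(algebraMap Fq[X] (Kbar Fq) s ^ Fintype.card Fq ^ m.natDegree * aeval u h) := by
      rw [hh] at hu
      rw [mul_pow, eq_neg_of_add_eq_zero_left hu]
      ring
    refine hred _ hsu _ ⟨_, IsIntegral.mem_of_mul_mem hm0 hred ?_ ?_, hpow⟩
    · exact ((isIntegral_algebraMap.pow _).mul (hint_aeval h)).neg
    · rw [← hpow]
      exact B.pow_mem hsu _
  obtain ⟨g, hg⟩ := exists_carlitz_eq_mul_add Fq hq m
  have hwint : IsIntegral Fq[X] w :=
    Algebra.adjoin_le (S := integralClosure Fq[X] (Kbar Fq))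
      (fun v hv => isIntegral_of_carlitz_eq_zero Fq hM hv) hw
  have hkey : algebraMap Fq[X] (Kbar Fq) s ^ 2 =
      algebraMap Fq[X] (Kbar Fq) m * -(w ^ 2 * aeval u g) := by
    rw [hg] at hu
    have h1 : algebraMap Fq[X] (Kbar Fq) m + u ^ 2 * aeval u g = 0 := by
      refine mul_left_cancel₀ hu0 ?_
      linear_combination hu
    refine mul_left_cancel₀ hm0 ?_
    linear_combination algebraMap Fq[X] (Kbar Fq) s ^ 2 * h1 -
      (algebraMap Fq[X] (Kbar Fq) s * u + algebraMap Fq[X] (Kbar Fq) m * w) * aeval u g * hsw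
  have hyint : IsIntegral Fq[X] (-(w ^ 2 * aeval u g)) := ((hwint.pow 2).mul (hint_aeval g)).neg
  have hy : -(w ^ 2 * aeval u g) = algebraMap (RatFunc Fq) (Kbar Fq)
      (algebraMap Fq[X] (RatFunc Fq) s ^ 2 / algebraMap Fq[X] (RatFunc Fq) m) := by
    rw [map_div₀, map_pow, ← IsScalarTower.algebraMap_apply, ← IsScalarTower.algebraMap_apply,
      eq_div_iff hm0, hkey, mul_comm]
  rw [hy, isIntegral_algebraMap_iff (algebraMap (RatFunc Fq) (Kbar Fq)).injective,
    IsIntegrallyClosed.isIntegral_iff] at hyint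
  obtain ⟨c, hc⟩ := hyint
  have hdvd : m ∣ s ^ 2 := by
    refine ⟨c, hinj ?_⟩
    rw [map_pow, hkey, hy, ← hc, map_mul, ← IsScalarTower.algebraMap_apply]
  exact hs (hm.prime.dvd_of_dvd_pow hdvd)


/-- Assume `q > 2`.  For `P ∈ Fq[T]` monic irreducible and `n ≥ 1`, the
extension `k(Λ_{P^n})/k(Λ_P)` is cyclotomic coradical: radical, separable and pure. -/
theorem cyclotomic_tower_isCycloCoradical (hq : 2 < Fintype.card Fq)
    (P : Polynomial Fq) (hmonic : P.Monic) (hirr : Irreducible P)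
    (n : ℕ) (hn : 1 ≤ n) :
    IsCycloCoradicalC Fq (adjoin (RatFunc Fq) (Lambda Fq P))
      (adjoin (RatFunc Fq) (Lambda Fq (P ^ n))) := by
  have hP : P ^ n ≠ 0 := pow_ne_zero n hirr.ne_zero
  refine ⟨⟨Lambda Fq (P ^ n), fun u hu => ⟨subset_adjoin _ _ hu, P ^ n, hP, ?_⟩, ?_⟩, ?_, ?_⟩
  · rw [show carlitz Fq (P ^ n) u = 0 from hu]
    exact zero_mem _
  · have hle : adjoin (RatFunc Fq) (Lambda Fq P) ≤ adjoin (RatFunc Fq) (Lambda Fq (P ^ n)) :=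
      adjoin.mono _ _ _ (Lambda_subset_of_dvd Fq (dvd_pow_self P (by omega)))
    refine le_antisymm (adjoin.mono _ _ _ Set.subset_union_right) ?_
    exact adjoin_le_iff.2 (Set.union_subset hle (subset_adjoin _ _))
  · intro u hu
    have hsep : Algebra.IsSeparable (RatFunc Fq) (adjoin (RatFunc Fq) (Lambda Fq (P ^ n))) :=
      (isSeparable_adjoin_iff_isSeparable _ _).2 fun v hv => isSeparable_of_carlitz_eq_zero Fq hP hv
    have hsu : IsSeparable (RatFunc Fq) u := isSeparable_of_mem_isSeparable _ _ hu
    exact hsu.tower_top _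
  · intro m hm u hu hmu
    have hunit : IsUnit (C m.leadingCoeff⁻¹) :=
      isUnit_C.2 (inv_ne_zero (leadingCoeff_ne_zero.2 hm.ne_zero)).isUnit
    have hirr' : Irreducible (C m.leadingCoeff⁻¹ * m) := (irreducible_isUnit_mul hunit).2 hm
    have hmu' : carlitz Fq (C m.leadingCoeff⁻¹ * m) u = 0 := by
      rw [carlitz_mul, hmu, carlitz_zero_right]
    have hmonic' : (C m.leadingCoeff⁻¹ * m).Monic := by
      rw [mul_comm]
      exact monic_mul_leadingCoeff_inv hm.ne_zero
    by_cases hdvd : C m.leadingCoeff⁻¹ * m ∣ P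
    · exact subset_adjoin _ _ (Lambda_subset_of_dvd Fq hdvd hmu')
    · have hcop := ((hirr'.coprime_iff_not_dvd).2 hdvd).pow_right (n := n)
      rw [eq_zero_of_mem_adjoin_Lambda Fq hq hirr' hmonic' (hmonic.pow n) hcop hu hmu']
      exact zero_mem _

end
end

section
/- Let K be a field with k ⊆ K ⊆ k̄ and let L = K({α_i}_{i∈I}) be a radical extension of K, where each α_i ∈ DrinT(L/K). For each i, let (a_i) be the nonzero ideal {m ∈ F_q[T] : C_m(α_i) ∈ K} of F_q[T] (a_i is called the order of α_i). Then L/K is a Galois extension if and only if Λ_{a_i} ⊆ L for every i (equivalently, a generator λ_{a_i} of the F_q[T]-module Λ_{a_i} lies in L for every i). -/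
open Polynomial IntermediateField

noncomputable section

variable (Fq : Type) [Field Fq] [Fintype Fq]

/-- The polynomial over `k` whose evaluation is the Carlitz action of `T ^ n`. -/
def carlitzPowPoly : ℕ → Polynomial (RatFunc Fq)
  | 0 => X
  | n + 1 => C RatFunc.X * carlitzPowPoly n + carlitzPowPoly n ^ Fintype.card Fq

/-- The polynomial over `k` whose evaluation is the Carlitz action of `a`. -/
def carlitzPoly (a : Polynomial Fq) : Polynomial (RatFunc Fq) :=
  ∑ i ∈ Finset.range (a.natDegree + 1),
    C (algebraMap Fq (RatFunc Fq) (a.coeff i)) * carlitzPowPoly Fq i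

theorem aeval_carlitzPowPoly (n : ℕ) (u : Kbar Fq) :
    aeval u (carlitzPowPoly Fq n) = (carlitzT Fq ^ n) u := by
  induction n with
  | zero => simp [carlitzPowPoly]
  | succ n ih =>
    rw [pow_succ', Module.End.mul_apply, ← ih]
    simp [carlitzPowPoly, carlitzT]

theorem aeval_carlitzPoly (a : Polynomial Fq) (u : Kbar Fq) :
    aeval u (carlitzPoly Fq a) = carlitz Fq a u := by
  rw [carlitz, carlitzHom, aeval_eq_sum_range (p := a), LinearMap.sum_apply, carlitzPoly, map_sum]
  refine Finset.sum_congr rfl fun i _ => ?_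
  rw [map_mul, aeval_carlitzPowPoly, aeval_C, LinearMap.smul_apply, Algebra.smul_def,
    ← IsScalarTower.algebraMap_apply]

theorem derivative_carlitzPowPoly (n : ℕ) :
    derivative (carlitzPowPoly Fq n) = C (RatFunc.X ^ n) := by
  have hq : ((Fintype.card Fq : ℕ) : RatFunc Fq) = 0 := by
    rw [← map_natCast (algebraMap Fq (RatFunc Fq)), FiniteField.cast_card_eq_zero, map_zero]
  induction n with
  | zero => simp [carlitzPowPoly]
  | succ n ih =>
    rw [carlitzPowPoly, derivative_add, derivative_C_mul, derivative_pow, ih, hq]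
    simp [pow_succ']

theorem derivative_carlitzPoly (a : Polynomial Fq) :
    derivative (carlitzPoly Fq a) = C (algebraMap (Polynomial Fq) (RatFunc Fq) a) := by
  conv_rhs => rw [a.as_sum_range_C_mul_X_pow]
  simp only [carlitzPoly, derivative_C_mul, derivative_carlitzPowPoly, map_sum,
    map_mul, map_pow, RatFunc.algebraMap_X, RatFunc.algebraMap_C, RatFunc.algebraMap_eq_C]

theorem natDegree_carlitzPowPoly_le (n : ℕ) :
    (carlitzPowPoly Fq n).natDegree ≤ Fintype.card Fq ^ n := by
  induction n with
  | zero => simp [carlitzPowPoly]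
  | succ n ih =>
    have hq : 1 ≤ Fintype.card Fq := Fintype.card_pos
    refine natDegree_add_le_of_degree_le ((natDegree_C_mul_le _ _).trans (ih.trans ?_))
      (natDegree_pow_le.trans ?_)
    · exact Nat.pow_le_pow_right hq n.le_succ
    · rw [pow_succ']
      gcongr

theorem natDegree_carlitzPoly_le (a : Polynomial Fq) :
    (carlitzPoly Fq a).natDegree ≤ Fintype.card Fq ^ a.natDegree := by
  refine natDegree_sum_le_of_forall_le _ _ fun i hi => ?_
  exact (natDegree_C_mul_le _ _).trans ((natDegree_carlitzPowPoly_le Fq i).trans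
    (Nat.pow_le_pow_right Fintype.card_pos (Nat.lt_succ_iff.1 (Finset.mem_range.1 hi))))

theorem carlitzPoly_ne_zero {a : Polynomial Fq} (ha : a ≠ 0) : carlitzPoly Fq a ≠ 0 := by
  intro h
  have := derivative_carlitzPoly Fq a
  rw [h, derivative_zero, eq_comm, C_eq_zero] at this
  exact ha ((map_eq_zero_iff _ (IsFractionRing.injective (Polynomial Fq) (RatFunc Fq))).1 this)

theorem Lambda_eq_rootSet {a : Polynomial Fq} (ha : a ≠ 0) :
    Lambda Fq a = (carlitzPoly Fq a).rootSet (Kbar Fq) := by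
  ext u
  rw [mem_rootSet_of_ne (carlitzPoly_ne_zero Fq ha), aeval_carlitzPoly]
  rfl

theorem finite_Lambda {a : Polynomial Fq} (ha : a ≠ 0) : (Lambda Fq a).Finite := by
  rw [Lambda_eq_rootSet Fq ha]
  exact rootSet_finite _ _

theorem ncard_Lambda_le {a : Polynomial Fq} (ha : a ≠ 0) :
    (Lambda Fq a).ncard ≤ Fintype.card Fq ^ a.natDegree := by
  classical
  rw [Lambda_eq_rootSet Fq ha, rootSet_def, Set.ncard_coe_finset]
  exact (Multiset.toFinset_card_le _).trans ((card_roots' _).trans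
    (natDegree_map_le.trans (natDegree_carlitzPoly_le Fq a)))

/-- A point with annihilator `(b)` generates `Λ_b`. -/
theorem exists_carlitz_eq_of_mem_Lambda {b : Polynomial Fq} (hb : b ≠ 0) {x : Kbar Fq}
    (hx : ∀ m, carlitz Fq m x = 0 ↔ b ∣ m) {y : Kbar Fq} (hy : y ∈ Lambda Fq b) :
    ∃ m, carlitz Fq m x = y := by
  let f : degreeLT Fq b.natDegree → Kbar Fq := fun m => carlitz Fq m x
  have hf : Function.Injective f := by
    intro m n hmn
    have h : carlitz Fq (m - n : Polynomial Fq) x = 0 := by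
      rw [carlitz, map_sub, LinearMap.sub_apply, sub_eq_zero]
      exact hmn
    have h0 := eq_zero_of_dvd_of_degree_lt ((hx _).1 h) (by
      rw [degree_eq_natDegree hb]
      exact mem_degreeLT.1 (m - n).2)
    exact Subtype.ext (sub_eq_zero.1 h0)
  have hsub : Set.range f ⊆ Lambda Fq b := by
    rintro _ ⟨m, rfl⟩
    change carlitzHom Fq b (carlitzHom Fq m x) = 0
    rw [← Module.End.mul_apply, ← map_mul]
    exact (hx _).2 (dvd_mul_right _ _)
  have hcard : (Set.range f).ncard = Fintype.card Fq ^ b.natDegree := by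
    rw [← Set.image_univ, Set.ncard_image_of_injective _ hf, Set.ncard_univ,
      Nat.card_congr (degreeLTEquiv Fq b.natDegree).toEquiv]
    simp
  have heq := Set.eq_of_subset_of_ncard_le hsub (hcard ▸ ncard_Lambda_le Fq hb)
    (finite_Lambda Fq hb)
  rw [← heq] at hy
  obtain ⟨m, hm⟩ := hy
  exact ⟨m, hm⟩

/-- A Carlitz submodule killed by a nonzero polynomial equals some `Λ_b`. -/
theorem exists_eq_Lambda {a : Polynomial Fq} (ha : a ≠ 0)
    (M : Submodule (Polynomial Fq) (Module.AEval' (carlitzT Fq)))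
    (hM : ∀ u : Kbar Fq, Module.AEval'.of (carlitzT Fq) u ∈ M → u ∈ Lambda Fq a) :
    ∃ b : Polynomial Fq, ∀ u : Kbar Fq,
      Module.AEval'.of (carlitzT Fq) u ∈ M ↔ u ∈ Lambda Fq b := by
  have hfin : Finite M := by
    have : Finite (Lambda Fq a) := finite_Lambda Fq ha
    refine Finite.of_injective
      (fun v : M => (⟨(Module.AEval'.of (carlitzT Fq)).symm v, hM _ (by simp)⟩ : Lambda Fq a))
      fun v w h => ?_
    simpa using h
  obtain ⟨x, hx⟩ := Module.exists_ker_toSpanSingleton_eq_annihilator (Polynomial Fq) M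
  obtain ⟨b, hb⟩ := (IsPrincipalIdealRing.principal (Module.annihilator (Polynomial Fq) M)).principal
  have hker : ∀ m, carlitz Fq m ((Module.AEval'.of (carlitzT Fq)).symm x) = 0 ↔ b ∣ m := by
    intro m
    rw [← Ideal.mem_span_singleton, ← Ideal.submodule_span_eq, ← hb, ← hx, LinearMap.mem_ker,
      LinearMap.toSpanSingleton_apply, Subtype.ext_iff]
    rfl
  have hann : ∀ m, m ∈ Module.annihilator (Polynomial Fq) M ↔ b ∣ m := by
    intro m
    rw [hb, Ideal.submodule_span_eq, Ideal.mem_span_singleton]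
  have hab : b ∣ a := (hann a).1 <| Module.mem_annihilator.2 fun v => Subtype.ext <|
    hM ((Module.AEval'.of (carlitzT Fq)).symm v) (by simp)
  have hb0 : b ≠ 0 := ne_zero_of_dvd_ne_zero ha hab
  refine ⟨b, fun u => ⟨fun hu => ?_, fun hu => ?_⟩⟩
  · exact congrArg Subtype.val (Module.mem_annihilator.1 ((hann b).2 dvd_rfl) ⟨_, hu⟩)
  · obtain ⟨m, rfl⟩ := exists_carlitz_eq_of_mem_Lambda Fq hb0 hker hu
    exact M.smul_mem m x.2

theorem carlitz_mem (F : IntermediateField (RatFunc Fq) (Kbar Fq)) (m : Polynomial Fq)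
    {u : Kbar Fq} (hu : u ∈ F) : carlitz Fq m u ∈ F := by
  rw [← aeval_carlitzPoly]
  exact (aeval_coe F ⟨u, hu⟩ (carlitzPoly Fq m)) ▸ (aeval (⟨u, hu⟩ : F) (carlitzPoly Fq m)).2

theorem carlitz_sub (m : Polynomial Fq) (u v : Kbar Fq) :
    carlitz Fq m (u - v) = carlitz Fq m u - carlitz Fq m v :=
  map_sub (carlitzHom Fq m) u v

theorem carlitz_algEquiv (K : IntermediateField (RatFunc Fq) (Kbar Fq))
    (σ : Gal((Kbar Fq)/K)) (m : Polynomial Fq) (u : Kbar Fq) :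
    carlitz Fq m (σ u) = σ (carlitz Fq m u) := by
  rw [← aeval_carlitzPoly, ← aeval_carlitzPoly]
  exact aeval_algHom_apply ((σ : Kbar Fq →ₐ[K] Kbar Fq).restrictScalars (RatFunc Fq)) u _

/-- Conjugates of a point of order dividing `a` over `K` differ from it by `a`-torsion. -/
theorem algEquiv_sub_mem_Lambda {K : IntermediateField (RatFunc Fq) (Kbar Fq)}
    {a : Polynomial Fq} {u : Kbar Fq} (hu : carlitz Fq a u ∈ K) (σ : Gal((Kbar Fq)/K)) :
    σ u - u ∈ Lambda Fq a := by
  change carlitz Fq a (σ u - u) = 0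
  rw [carlitz_sub, carlitz_algEquiv, sub_eq_zero]
  exact σ.commutes ⟨_, hu⟩

theorem isSeparable_of_carlitz_mem {K : IntermediateField (RatFunc Fq) (Kbar Fq)}
    {a : Polynomial Fq} (ha : a ≠ 0) {u : Kbar Fq} (hu : carlitz Fq a u ∈ K) :
    IsSeparable K u := by
  let P : Polynomial K := (carlitzPoly Fq a).map (algebraMap (RatFunc Fq) K) - C ⟨_, hu⟩
  have hP : P.Separable := by
    have hder : derivative P =
        C (algebraMap (RatFunc Fq) K (algebraMap (Polynomial Fq) (RatFunc Fq) a)) := by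
      rw [derivative_sub, derivative_C, sub_zero, derivative_map, derivative_carlitzPoly, map_C]
    rw [separable_def, hder]
    refine isCoprime_one_right.of_isCoprime_of_dvd_right (isUnit_C.2 ?_).dvd
    rw [isUnit_iff_ne_zero, Ne, map_eq_zero,
      map_eq_zero_iff _ (IsFractionRing.injective (Polynomial Fq) (RatFunc Fq))]
    exact ha
  refine hP.of_dvd (minpoly.dvd K u ?_)
  rw [map_sub, aeval_map_algebraMap, aeval_carlitzPoly, aeval_C]
  exact sub_self _

/-- In a Galois extension `L/K`, if the torsion points `σ u - u` are all killed by `b`, then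
`C_b(u)` lies in `K`. -/
theorem carlitz_mem_of_forall_algEquiv_sub_mem {K L : IntermediateField (RatFunc Fq) (Kbar Fq)}
    (hKL : K ≤ L) [IsGalois K (extendScalars hKL)] {u : Kbar Fq} (hu : u ∈ L)
    {b : Polynomial Fq} (hb : ∀ σ : Gal((Kbar Fq)/K), σ u - u ∈ Lambda Fq b) :
    carlitz Fq b u ∈ K := by
  let x : extendScalars hKL := ⟨carlitz Fq b u, carlitz_mem Fq L b hu⟩
  obtain ⟨y, hy⟩ := (InfiniteGalois.mem_range_algebraMap_iff_fixed (k := K) x).2 fun τ => by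
    have h : carlitz Fq b (τ.liftNormal (Kbar Fq) u - u) = 0 := hb (τ.liftNormal (Kbar Fq))
    rw [carlitz_sub, carlitz_algEquiv, sub_eq_zero] at h
    exact Subtype.ext ((τ.liftNormal_commutes (Kbar Fq) x).symm.trans h)
  have : (y : Kbar Fq) = carlitz Fq b u := congrArg Subtype.val hy
  exact this ▸ y.2

theorem Lambda_subset_of_isGalois {K L : IntermediateField (RatFunc Fq) (Kbar Fq)}
    (hKL : K ≤ L) [IsGalois K (extendScalars hKL)] {u : Kbar Fq} (hu : u ∈ L)
    {a : Polynomial Fq} (ha : a ≠ 0) (hord : ∀ m, carlitz Fq m u ∈ K ↔ a ∣ m) :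
    Lambda Fq a ⊆ (L : Set (Kbar Fq)) := by
  let e := Module.AEval'.of (carlitzT Fq)
  let M : Submodule (Polynomial Fq) (Module.AEval' (carlitzT Fq)) :=
    Submodule.span _ (Set.range fun σ : Gal((Kbar Fq)/K) => e (σ u - u))
  have hM : ∀ v ∈ M, e.symm v ∈ Lambda Fq a ∧ e.symm v ∈ L := by
    intro v hv
    induction hv using Submodule.span_induction with
    | mem v hv =>
      obtain ⟨σ, rfl⟩ := hv
      refine ⟨algEquiv_sub_mem_Lambda Fq ((hord a).2 dvd_rfl) σ, sub_mem ?_ hu⟩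
      have hnorm : Normal K (extendScalars hKL) := inferInstance
      exact normal_iff_forall_map_le'.1 hnorm σ ⟨u, hu, rfl⟩
    | zero => exact ⟨map_zero (carlitzHom Fq a), zero_mem L⟩
    | add v w _ _ hv hw =>
      refine ⟨?_, add_mem hv.2 hw.2⟩
      exact (map_add (carlitzHom Fq a) _ _).trans
        ((congrArg₂ (· + ·) hv.1 hw.1).trans (add_zero _))
    | smul m v _ hv =>
      refine ⟨?_, carlitz_mem Fq L m hv.2⟩
      change carlitzHom Fq a (carlitzHom Fq m (e.symm v)) = 0
      rw [← Module.End.mul_apply, ← map_mul, mul_comm, map_mul, Module.End.mul_apply]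
      exact (congrArg (carlitzHom Fq m) hv.1).trans (map_zero _)
  obtain ⟨b, hb⟩ := exists_eq_Lambda Fq ha M fun v hv => (hM _ hv).1
  have hab : a ∣ b := (hord b).1 <| carlitz_mem_of_forall_algEquiv_sub_mem Fq hKL hu fun σ =>
    (hb _).1 (Submodule.subset_span ⟨σ, rfl⟩)
  obtain ⟨c, rfl⟩ := hab
  intro v hv
  refine (hM (e v) ((hb v).2 ?_)).2
  change carlitzHom Fq (a * c) v = 0
  rw [mul_comm, map_mul, Module.End.mul_apply]
  exact (congrArg (carlitzHom Fq c) hv).trans (map_zero _)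

/-- Let `L = K({α_i})` be a radical extension of `K`, each `α_i` lying in
`DrinT(L/K)`, and for each `i` let `(a i)` be the nonzero ideal
`{m : C_m(α_i) ∈ K}` of `Fq[T]` (`a i` is the order of `α_i`).  Then `L/K` is Galois if
and only if `Λ_{a i} ⊆ L` for every `i`. -/
theorem radical_isGalois_iff (K L : IntermediateField (RatFunc Fq) (Kbar Fq))
    (hKL : K ≤ L) {ι : Type} (α : ι → Kbar Fq)
    (hmem : ∀ i, α i ∈ DrinT Fq K L)
    (hL : L = adjoin (RatFunc Fq) ((K : Set (Kbar Fq)) ∪ Set.range α))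
    (a : ι → Polynomial Fq) (ha : ∀ i, a i ≠ 0)
    (hord : ∀ i (m : Polynomial Fq), carlitz Fq m (α i) ∈ K ↔ a i ∣ m) :
    IsGalois K (extendScalars hKL) ↔ ∀ i, Lambda Fq (a i) ⊆ (L : Set (Kbar Fq)) := by
  have hadj : extendScalars hKL = adjoin K (Set.range α) := by
    apply restrictScalars_injective (RatFunc Fq)
    rw [extendScalars_restrictScalars, hL, adjoin_union, adjoin_self,
      restrictScalars_adjoin_eq_sup]
  have hαK i : carlitz Fq (a i) (α i) ∈ K := (hord i _).2 dvd_rfl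
  refine ⟨fun _ i => Lambda_subset_of_isGalois Fq hKL (hmem i).1 (ha i) (hord i), fun h => ?_⟩
  have hsep : Algebra.IsSeparable K (extendScalars hKL) := by
    rw [hadj, isSeparable_adjoin_iff_isSeparable]
    rintro _ ⟨i, rfl⟩
    exact isSeparable_of_carlitz_mem Fq (ha i) (hαK i)
  have hnorm : Normal K (extendScalars hKL) := by
    refine normal_iff_forall_map_le'.2 fun σ => ?_
    rw [map_le_iff_le_comap]
    conv_lhs => rw [hadj]
    rw [adjoin_le_iff]
    rintro _ ⟨i, rfl⟩
    have := add_mem (h i (algEquiv_sub_mem_Lambda Fq (hαK i) σ)) (hmem i).1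
    rwa [sub_add_cancel] at this
  exact ⟨⟩

end
end
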